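/- The signed bigrassmannian polynomials satisfy the recursion: B₁(q) = 1, B₂(q) = 1 − q, and for every integer n ≥ 3, B_n(q)·B_{n−2}(q) = B_{n−1}(q)²·(1 − q^{n−1}) as an identity in ℤ[q]. -/

import Mathlib

/-- The length ℓ(w) = |N(w)|, the number of inversions of `w`, where
N(w) = {(i,j) : i < j and w⁻¹(i) > w⁻¹(j)}. -/
def permLen {n : ℕ} (w : Equiv.Perm (Fin n)) : ℕ :=
  (Finset.univ.filter
    (fun p : Fin n × Fin n => p.1 < p.2 ∧ w⁻¹ p.2 < w⁻¹ p.1)).card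

/-- The bigrassmannian statistic β(w) = Σ_{(i,j)∈N(w)} (j−i). -/
def permBeta {n : ℕ} (w : Equiv.Perm (Fin n)) : ℕ :=
  ∑ p ∈ Finset.univ.filter
      (fun p : Fin n × Fin n => p.1 < p.2 ∧ w⁻¹ p.2 < w⁻¹ p.1),
    ((p.2 : ℕ) - (p.1 : ℕ))

/-- The n-th signed bigrassmannian polynomial
B_n(q) = Σ_{w∈S_n} (−1)^{ℓ(w)} q^{β(w)} in ℤ[q]. -/
noncomputable def B (n : ℕ) : Polynomial ℤ :=
  ∑ w : Equiv.Perm (Fin n),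
    (-1 : Polynomial ℤ) ^ permLen w * Polynomial.X ^ permBeta w

open Finset in
/-- The sum of the values `j - i` over the inversions of `u` is `∑ a, a * (a - u a)`. -/
theorem sum_inversions_sub {n : ℕ} (u : Equiv.Perm (Fin n)) :
    ∑ p ∈ univ.filter (fun p : Fin n × Fin n => p.1 < p.2 ∧ u p.2 < u p.1),
      ((p.2 : ℤ) - (p.1 : ℤ)) = ∑ a : Fin n, (a : ℤ) * ((a : ℤ) - (u a : ℤ)) := by
  have card_lt (a : Fin n) : ∑ i : Fin n, (if i < a then (1 : ℤ) else 0) = a := by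
    rw [sum_boole, filter_gt_eq_Iio, Fin.card_Iio]
  have card_lt' (a : Fin n) : ∑ i : Fin n, (if u i < u a then (1 : ℤ) else 0) = u a := by
    rw [Equiv.sum_comp u (fun i => if i < u a then (1 : ℤ) else 0), card_lt]
  let f (i j : Fin n) : ℤ := if i < j ∧ u j < u i then 1 else 0
  have indicator_sub (i a : Fin n) :
      f i a - f a i = (if i < a then (1 : ℤ) else 0) - (if u i < u a then 1 else 0) := by
    have h : i = a ↔ u i = u a := u.injective.eq_iff.symm
    simp only [f]
    grind
  calc
    _ = ∑ i, ∑ j, f i j * ((j : ℤ) - (i : ℤ)) := by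
      rw [sum_filter, Fintype.sum_prod_type]
      simp only [f, ite_mul, one_mul, zero_mul]
    _ = ∑ a : Fin n, ∑ i, (a : ℤ) * (f i a - f a i) := by
      simp only [mul_sub, sum_sub_distrib]
      rw [sum_comm]
      simp only [mul_comm]
    _ = _ := by
      simp only [← mul_sum, indicator_sub, sum_sub_distrib, card_lt, card_lt']

theorem permBeta_cast {n : ℕ} (w : Equiv.Perm (Fin n)) :
    (permBeta w : ℤ) = ∑ a : Fin n, (a : ℤ) * ((a : ℤ) - (w⁻¹ a : ℤ)) := by
  rw [← sum_inversions_sub, permBeta, Nat.cast_sum]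
  refine Finset.sum_congr rfl fun p hp => ?_
  have h : (p.1 : ℕ) < p.2 := (Finset.mem_filter.mp hp).2.1
  push_cast [h.le]
  rfl

theorem permBeta_add {n : ℕ} (w : Equiv.Perm (Fin n)) :
    permBeta w + ∑ a : Fin n, (a.rev : ℕ) * (a : ℕ) =
      ∑ a : Fin n, ((w⁻¹ a).rev : ℕ) * (a : ℕ) := by
  have rev_cast (a : Fin n) : ((a.rev : ℕ) : ℤ) = (n : ℤ) - 1 - a := by
    rw [Fin.val_rev]
    omega
  zify
  rw [permBeta_cast, ← Finset.sum_add_distrib]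
  refine Finset.sum_congr rfl fun a _ => ?_
  rw [rev_cast, rev_cast]
  ring

open Finset in
theorem neg_one_pow_permLen {R : Type*} [CommRing R] {n : ℕ} (w : Equiv.Perm (Fin n)) :
    (-1 : R) ^ permLen w = ((Equiv.Perm.sign w⁻¹ : ℤ) : R) := by
  have hsign : ((-1 : ℤˣ)) ^ permLen w = Equiv.Perm.sign w⁻¹ := by
    rw [Equiv.Perm.sign_eq_prod_prod_Ioi, permLen, ← prod_const, prod_filter,
      Fintype.prod_prod_type]
    refine prod_congr rfl fun i _ => ?_
    rw [← filter_lt_eq_Ioi, prod_filter]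
    refine prod_congr rfl fun j _ => ?_
    have h : i = j ↔ w⁻¹ i = w⁻¹ j := w⁻¹.injective.eq_iff.symm
    grind
  rw [← hsign]
  push_cast
  rfl

open Polynomial in
/-- `B n` is, up to a power of `X`, the Vandermonde determinant at `X ^ (n - 1), …, X, 1`. -/
theorem B_mul_X_pow (n : ℕ) :
    B n * X ^ (∑ a : Fin n, (a.rev : ℕ) * (a : ℕ)) =
      (Matrix.vandermonde fun a : Fin n => (X : ℤ[X]) ^ (a.rev : ℕ)).det := by
  rw [B, Finset.sum_mul, Matrix.det_apply']
  refine Fintype.sum_equiv (Equiv.inv _) _ _ fun w => ?_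
  rw [mul_assoc, ← pow_add, permBeta_add, neg_one_pow_permLen]
  simp only [Matrix.vandermonde_apply, ← pow_mul, Finset.prod_pow_eq_pow_sum, Equiv.inv_apply]

open Polynomial Finset in
theorem B_eq_prod (n : ℕ) :
    B n = ∏ j ∈ range n, ∏ k ∈ range j, (1 - X ^ (k + 1) : ℤ[X]) := by
  have inner_prod (j : Fin n) :
      ∏ i ∈ Iio j, ((X : ℤ[X]) ^ (j.rev : ℕ) - X ^ (i.rev : ℕ)) =
        X ^ ((j.rev : ℕ) * (j : ℕ)) * ∏ k ∈ range j, (1 - X ^ (k + 1)) := by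
    calc
      _ = ∏ i ∈ Iio j, ((X : ℤ[X]) ^ (j.rev : ℕ) * (1 - X ^ ((j : ℕ) - i))) := by
        refine prod_congr rfl fun i hi => ?_
        have hij : i < j := mem_Iio.mp hi
        have hrev : (i.rev : ℕ) = j.rev + (j - i) := by
          simp only [Fin.val_rev]
          omega
        rw [hrev, pow_add]
        ring
      _ = ∏ i ∈ range j, ((X : ℤ[X]) ^ (j.rev : ℕ) * (1 - X ^ ((j : ℕ) - i))) := by
        rw [← Nat.Iio_eq_range, ← Fin.map_valEmbedding_Iio, prod_map]
        rfl
      _ = _ := by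
        rw [prod_mul_distrib, prod_const, card_range, ← pow_mul, ← prod_range_reflect]
        congr 1
        refine prod_congr rfl fun i hi => ?_
        have hij := mem_range.mp hi
        congr 2
        omega
  have hX : (X : ℤ[X]) ^ (∑ a : Fin n, (a.rev : ℕ) * (a : ℕ)) ≠ 0 := pow_ne_zero _ X_ne_zero
  refine mul_right_cancel₀ hX ?_
  rw [B_mul_X_pow, Matrix.det_vandermonde,
    prod_comm' (t' := univ) (s' := fun j => Iio j) (by simp), prod_congr rfl fun j _ => inner_prod j,
    prod_mul_distrib, prod_pow_eq_pow_sum, mul_comm,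
    Fin.prod_univ_eq_prod_range (fun j => ∏ k ∈ range j, (1 - X ^ (k + 1) : ℤ[X]))]

/-- B₁(q) = 1, B₂(q) = 1 − q, and for every n ≥ 3,
B_n(q)·B_{n−2}(q) = B_{n−1}(q)²·(1 − q^{n−1}) in ℤ[q]. -/
theorem signed_bigrassmannian_stmt15 :
    B 1 = 1 ∧ B 2 = 1 - Polynomial.X ∧
    ∀ n : ℕ, 3 ≤ n →
      B n * B (n - 2) = (B (n - 1)) ^ 2 * (1 - Polynomial.X ^ (n - 1)) := by
  refine ⟨by simp [B_eq_prod], by simp [B_eq_prod, Finset.prod_range_succ], fun n hn => ?_⟩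
  obtain ⟨m, rfl⟩ := Nat.exists_eq_add_of_le' hn
  simp only [B_eq_prod, show m + 3 - 2 = m + 1 by omega, show m + 3 - 1 = m + 2 by omega,
    Finset.prod_range_succ]
  ring
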